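/- arXiv:0910.5887 — 3 statements merged into one kernel-verified Lean document; each statement's English description precedes it below -/
import Mathlib

section
/- Let ι be a type and r : ι → ℝ with r i ≥ 0 for all i. Assume there exist constants C ≥ 0 and L ≥ 0 such that for every R ≥ 0 the set {i ∈ ι | r i ≤ R} is finite with cardinality at most C · exp(L · R). Then for every real s > L the family (exp(−s · r i))_{i ∈ ι} is summable. -/
open Real

/-- If the counting function `N(R) = Card {i | r i ≤ R}` grows at most like `C * exp (L * R)`,
then the Poincaré-type series `∑ i, exp (-s * r i)` is summable for every `s > L`. -/
theorem summable_of_counting_le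
    {ι : Type*} (r : ι → ℝ) (hr : ∀ i, 0 ≤ r i) (C L : ℝ) (hC : 0 ≤ C) (hL : 0 ≤ L)
    (hcount : ∀ R : ℝ, 0 ≤ R →
      {i : ι | r i ≤ R}.Finite ∧ ({i : ι | r i ≤ R}.ncard : ℝ) ≤ C * Real.exp (L * R)) :
    ∀ s : ℝ, L < s → Summable (fun i => Real.exp (-s * r i)) := by
  intro s hs
  have hs0 : 0 ≤ s := hL.trans hs.le
  have hg : Summable fun n : ℕ => C * Real.exp L * Real.exp (L - s) ^ n :=
    (summable_geometric_of_lt_one (Real.exp_pos _).le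
      (Real.exp_lt_one_iff.2 (sub_neg.2 hs))).mul_left _
  refine summable_of_sum_le (c := ∑' n : ℕ, C * Real.exp L * Real.exp (L - s) ^ n)
    (fun i => (Real.exp_pos _).le) fun u => ?_
  rw [← Finset.sum_fiberwise_of_maps_to
    (fun i hi => Finset.mem_image_of_mem (fun i => ⌊r i⌋₊) hi)]
  refine (Finset.sum_le_sum fun n _ => ?_).trans
    (hg.sum_le_tsum (u.image fun i => ⌊r i⌋₊) fun n _ => by positivity)
  obtain ⟨hfin, hcard⟩ := hcount (n + 1) (by positivity)
  have hfiber : ((u.filter fun i => ⌊r i⌋₊ = n).card : ℝ) ≤ C * Real.exp (L * (n + 1)) := by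
    refine le_trans ?_ hcard
    rw [← Set.ncard_coe_finset]
    refine Nat.cast_le.2 (Set.ncard_le_ncard (fun i hi => ?_) hfin)
    have hi : ⌊r i⌋₊ = n := (Finset.mem_filter.1 hi).2
    exact hi ▸ (Nat.lt_floor_add_one (r i)).le
  calc
    ∑ i ∈ u with ⌊r i⌋₊ = n, Real.exp (-s * r i)
        ≤ (u.filter fun i => ⌊r i⌋₊ = n).card • Real.exp (-s * n) := by
      refine Finset.sum_le_card_nsmul _ _ _ fun i hi => Real.exp_le_exp.2 ?_
      have hi : (n : ℝ) ≤ r i := (Finset.mem_filter.1 hi).2 ▸ Nat.floor_le (hr i)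
      nlinarith
    _ ≤ C * Real.exp (L * (n + 1)) * Real.exp (-s * n) := by
      rw [nsmul_eq_mul]
      gcongr
    _ = C * Real.exp L * Real.exp (L - s) ^ n := by
      rw [← Real.exp_nat_mul, mul_assoc, mul_assoc, ← Real.exp_add, ← Real.exp_add]
      ring_nf
end

section
/- Let n, p be real numbers with k := n − 1 − p > 0, let I ⊆ ℝ be an open interval, and let f, u : ℝ → ℝ be such that f is twice differentiable on I, f(t) > 0 and u(t) > 0 for all t ∈ I, and for all t ∈ I: f'(t) = k · u(t) · f(t) and f''(t) = ((n−p) · u(t) + (p−1)/u(t)) · f'(t) − k · p · f(t). Then the function g(t) := f(t)^(−1/k) satisfies g''(t) = g(t) for all t ∈ I. -/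
open Real

/-- The second derivative of a real power of a positive, twice differentiable function. -/
theorem deriv_deriv_rpow_const_of_pos {s : Set ℝ} (hs : IsOpen s) {f : ℝ → ℝ} (r : ℝ)
    (hf1 : ∀ t ∈ s, DifferentiableAt ℝ f t) (hfpos : ∀ t ∈ s, 0 < f t) {t : ℝ} (ht : t ∈ s)
    (hf2 : DifferentiableAt ℝ (deriv f) t) :
    deriv (deriv fun x => f x ^ r) t =
      r * (deriv (deriv f) t * f t + (r - 1) * deriv f t ^ 2) / f t ^ 2 * f t ^ r := by
  have hderiv : deriv (fun x => f x ^ r) =ᶠ[nhds t] fun x => deriv f x * r * f x ^ (r - 1) := by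
    filter_upwards [hs.mem_nhds ht] with x hx
    exact ((hf1 x hx).hasDerivAt.rpow_const (Or.inl (hfpos x hx).ne')).deriv
  have hpos := hfpos t ht
  have hpow := (hf1 t ht).hasDerivAt.rpow_const (p := r - 1) (Or.inl hpos.ne')
  rw [hderiv.deriv_eq, ((hf2.hasDerivAt.mul_const r).fun_mul hpow).deriv,
    rpow_sub_one hpos.ne' (r - 1), rpow_sub_one hpos.ne' r]
  field_simp

/-- ODE reduction in the equality case of the refined Kato inequality: if `f` satisfies
`f' = k u f` and `f'' = ((n-p) u + (p-1)/u) f' - k p f` on an open interval, with `f, u > 0`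
and `k = n - 1 - p > 0`, then `g = f^(-1/k)` satisfies `g'' = g` on that interval. -/
theorem kato_ode_reduction
    (n p : ℝ) (k : ℝ) (hk : k = n - 1 - p) (hkpos : 0 < k)
    (a b : ℝ) (f u : ℝ → ℝ)
    (hf1 : ∀ t ∈ Set.Ioo a b, DifferentiableAt ℝ f t)
    (hf2 : ∀ t ∈ Set.Ioo a b, DifferentiableAt ℝ (deriv f) t)
    (hfpos : ∀ t ∈ Set.Ioo a b, 0 < f t)
    (hupos : ∀ t ∈ Set.Ioo a b, 0 < u t)
    (hODE1 : ∀ t ∈ Set.Ioo a b, deriv f t = k * u t * f t)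
    (hODE2 : ∀ t ∈ Set.Ioo a b,
      deriv (deriv f) t = ((n - p) * u t + (p - 1) / u t) * deriv f t - k * p * f t)
    (g : ℝ → ℝ) (hg : ∀ t, g t = f t ^ (-1 / k)) :
    ∀ t ∈ Set.Ioo a b, deriv (deriv g) t = g t := by
  intro t ht
  have hf := (hfpos t ht).ne'
  have hu := (hupos t ht).ne'
  have hn : n = k + 1 + p := by linarith
  rw [funext hg, deriv_deriv_rpow_const_of_pos isOpen_Ioo _ hf1 hfpos ht (hf2 t ht),
    hODE2 t ht, hODE1 t ht, hn]
  field_simp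
  ring
end

section
/- Let (Ω, μ) be a measure space, ρ : Ω → ℝ measurable with ρ ≥ 0, and F : Ω → [0,∞] measurable. Let D > 0, σ > 0, δ > 0 and C > 0 be real constants with D < 2√σ · δ. Assume: (i) μ({x : ρ(x) ≤ R}) ≤ C · exp(D · R) for every R ≥ 1; (ii) ∫_{{ρ ≤ 1}} F dμ ≤ C; and (iii) for every integer k ≥ 1, ∫_{{x : k ≤ ρ(x) ≤ k+1}} F dμ ≤ C · k · exp(−2√σ · k). Then ∫_Ω F^{δ/(δ+1)} dμ < ∞. -/
open Real MeasureTheory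

/-- Hölder's inequality on a set, with conjugate exponents `δ / (δ + 1)` and `1 / (δ + 1)`. -/
theorem setLIntegral_rpow_le_measure_rpow_mul {Ω : Type*} [MeasurableSpace Ω] (μ : Measure Ω)
    {F : Ω → ENNReal} (hF : Measurable F) {δ : ℝ} (hδ : 0 < δ) (A : Set Ω) :
    (∫⁻ x in A, F x ^ (δ / (δ + 1)) ∂μ) ≤
      μ A ^ (1 / (δ + 1)) * (∫⁻ x in A, F x ∂μ) ^ (δ / (δ + 1)) := by
  have h := ENNReal.lintegral_mul_norm_pow_le (μ := μ.restrict A) (f := fun _ => 1) (g := F)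
    (p := 1 / (δ + 1)) (q := δ / (δ + 1)) aemeasurable_const hF.aemeasurable
    (by positivity) (by positivity) (by field_simp; ring)
  simpa using h

/-- The product of the volume and annulus bounds, raised to their Hölder exponents, is dominated
by a polynomial times a decaying exponential. -/
theorem volume_rpow_mul_decay_rpow_le {D s δ C k : ℝ} (hδ : 0 < δ) (hC : 0 < C) (hk : 1 ≤ k) :
    (C * Real.exp (D * (k + 1))) ^ (1 / (δ + 1)) *
        (C * k * Real.exp (-s * k)) ^ (δ / (δ + 1)) ≤
      C * Real.exp (D / (δ + 1)) *
        (k * Real.exp (-((s * δ - D) / (δ + 1)) * k)) := by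
  have hk0 : 0 < k := by linarith
  have hpow : k ^ (δ / (δ + 1)) ≤ k := by
    simpa using Real.rpow_le_rpow_of_exponent_le hk
      (show δ / (δ + 1) ≤ 1 by rw [div_le_one (by positivity)]; linarith)
  have hCC : C ^ (1 / (δ + 1)) * C ^ (δ / (δ + 1)) = C := by
    rw [← Real.rpow_add hC, show 1 / (δ + 1) + δ / (δ + 1) = 1 by field_simp; ring, Real.rpow_one]
  have hexp : Real.exp (D * (k + 1) * (1 / (δ + 1))) * Real.exp (-s * k * (δ / (δ + 1))) =
      Real.exp (D / (δ + 1)) * Real.exp (-((s * δ - D) / (δ + 1)) * k) := by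
    rw [← Real.exp_add, ← Real.exp_add]
    congr 1
    field_simp
    ring
  rw [Real.mul_rpow hC.le (Real.exp_pos _).le, Real.mul_rpow (by positivity) (Real.exp_pos _).le,
    Real.mul_rpow hC.le hk0.le, ← Real.exp_mul, ← Real.exp_mul]
  calc _ = (C ^ (1 / (δ + 1)) * C ^ (δ / (δ + 1))) * k ^ (δ / (δ + 1)) *
        (Real.exp (D * (k + 1) * (1 / (δ + 1))) * Real.exp (-s * k * (δ / (δ + 1)))) := by ring
    _ = C * k ^ (δ / (δ + 1)) *
        (Real.exp (D / (δ + 1)) * Real.exp (-((s * δ - D) / (δ + 1)) * k)) := by rw [hCC, hexp]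
    _ ≤ C * k * (Real.exp (D / (δ + 1)) * Real.exp (-((s * δ - D) / (δ + 1)) * k)) := by gcongr
    _ = _ := by ring

/-- Abstract form of the lemma that `φ = |ξ|^{δ/(δ+1)}` is square integrable: given volume
growth of exponent `D`, a bound on `∫_{ρ ≤ 1} F`, and exponential decay
`∫_{k ≤ ρ ≤ k+1} F ≤ C k e^{-2√σ k}` on annuli, with `D < 2√σ δ`, the pointwise power
`F^{δ/(δ+1)}` is integrable. -/
theorem power_integrable_of_decay
    {Ω : Type*} [MeasurableSpace Ω] (μ : Measure Ω)
    (ρ : Ω → ℝ) (hρm : Measurable ρ) (hρ : ∀ x, 0 ≤ ρ x)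
    (F : Ω → ENNReal) (hFm : Measurable F)
    (D σ δ C : ℝ) (hD : 0 < D) (hσ : 0 < σ) (hδ : 0 < δ) (hC : 0 < C)
    (hDσδ : D < 2 * Real.sqrt σ * δ)
    (hvol : ∀ R : ℝ, 1 ≤ R → μ {x | ρ x ≤ R} ≤ ENNReal.ofReal (C * Real.exp (D * R)))
    (hbase : (∫⁻ x in {x | ρ x ≤ 1}, F x ∂μ) ≤ ENNReal.ofReal C)
    (hannuli : ∀ k : ℕ, 1 ≤ k →
      (∫⁻ x in {x | (k : ℝ) ≤ ρ x ∧ ρ x ≤ (k : ℝ) + 1}, F x ∂μ) ≤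
        ENNReal.ofReal (C * k * Real.exp (-(2 * Real.sqrt σ) * k))) :
    (∫⁻ x, F x ^ (δ / (δ + 1)) ∂μ) < ⊤ := by
  set A : ℕ → Set Ω := fun n => {x | ((n + 1 : ℕ) : ℝ) ≤ ρ x ∧ ρ x ≤ ((n + 1 : ℕ) : ℝ) + 1} with hA
  set r : ℝ := (2 * Real.sqrt σ * δ - D) / (δ + 1) with hr
  have hr0 : 0 < r := div_pos (by linarith) (by linarith)
  have hcover : {x | ρ x ≤ 1} ∪ ⋃ n, A n = Set.univ := by
    refine Set.eq_univ_of_forall fun x => ?_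
    rcases le_total (ρ x) 1 with h | h
    · exact Or.inl h
    · have hfloor : 1 ≤ ⌊ρ x⌋₊ := Nat.one_le_floor_iff _ |>.2 h
      refine Or.inr (Set.mem_iUnion.2 ⟨⌊ρ x⌋₊ - 1, ?_⟩)
      rw [hA, Set.mem_ofPred_eq, Nat.sub_add_cancel hfloor]
      exact ⟨Nat.floor_le (hρ x), (Nat.lt_floor_add_one _).le⟩
  have hball : (∫⁻ x in {x | ρ x ≤ 1}, F x ^ (δ / (δ + 1)) ∂μ) < ⊤ := by
    refine (setLIntegral_rpow_le_measure_rpow_mul μ hFm hδ _).trans_lt (ENNReal.mul_lt_top ?_ ?_)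
    · exact ENNReal.rpow_lt_top_of_nonneg (by positivity)
        ((hvol 1 le_rfl).trans_lt ENNReal.ofReal_lt_top).ne
    · exact ENNReal.rpow_lt_top_of_nonneg (by positivity)
        (hbase.trans_lt ENNReal.ofReal_lt_top).ne
  have hannulus (n : ℕ) : (∫⁻ x in A n, F x ^ (δ / (δ + 1)) ∂μ) ≤
      ENNReal.ofReal (C * Real.exp (D / (δ + 1)) *
        (((n + 1 : ℕ) : ℝ) * Real.exp (-r * ((n + 1 : ℕ) : ℝ)))) := by
    have hk : (1 : ℝ) ≤ ((n + 1 : ℕ) : ℝ) := by exact_mod_cast Nat.le_add_left 1 n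
    have hμ : μ (A n) ≤ ENNReal.ofReal (C * Real.exp (D * (((n + 1 : ℕ) : ℝ) + 1))) :=
      (measure_mono fun x hx => hx.2).trans (hvol _ (by linarith))
    calc _ ≤ _ := setLIntegral_rpow_le_measure_rpow_mul μ hFm hδ (A n)
      _ ≤ _ := mul_le_mul' (ENNReal.rpow_le_rpow hμ (by positivity))
        (ENNReal.rpow_le_rpow (hannuli (n + 1) (Nat.le_add_left 1 n)) (by positivity))
      _ ≤ _ := by
        rw [ENNReal.ofReal_rpow_of_nonneg (by positivity) (by positivity),
          ENNReal.ofReal_rpow_of_nonneg (by positivity) (by positivity),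
          ← ENNReal.ofReal_mul (by positivity)]
        exact ENNReal.ofReal_le_ofReal (volume_rpow_mul_decay_rpow_le hδ hC hk)
  have hsum : Summable fun n : ℕ => C * Real.exp (D / (δ + 1)) *
      (((n + 1 : ℕ) : ℝ) * Real.exp (-r * ((n + 1 : ℕ) : ℝ))) := by
    have h := Real.summable_pow_mul_exp_neg_nat_mul 1 hr0
    simp only [pow_one] at h
    exact ((summable_nat_add_iff 1).2 h).mul_left _
  rw [← setLIntegral_univ, ← hcover]
  calc _ ≤ _ := lintegral_union_le _ _ _
    _ ≤ _ := add_le_add le_rfl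
      ((lintegral_iUnion_le _ _).trans (ENNReal.tsum_le_tsum hannulus))
    _ < ⊤ := ENNReal.add_lt_top.2 ⟨hball, hsum.tsum_ofReal_lt_top⟩
end
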